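/- arXiv:2511.09718 — 2 statements merged into one kernel-verified Lean document; each statement's English description precedes it below -/
import Mathlib

section
/- For every c ∈ Σ = {0,1}^ℕ, the σ-limit set of the point x_c under the shift map T equals exactly the two constant sequences: σ_T(x_c) = {0^∞, 1^∞}. -/
open MeasureTheory Set Filter Topology

/-- The full two-sided alphabet shift space `Σ = {0,1}^ℕ` (with `1 = true`). -/
abbrev Sig : Type := ℕ → Bool

/-- The shift map on `Σ`. -/
def shiftMap : Sig → Sig := fun x i => x (i + 1)

/-- Birkhoff average of visits of the orbit of `x` to `U` up to time `n`. -/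
noncomputable def birkhoffAvg {X : Type*} (f : X → X) (U : Set X) (n : ℕ) (x : X) : ℝ :=
  (∑ k ∈ Finset.range n, U.indicator (fun _ => (1:ℝ)) (f^[k] x)) / n

/-- The σ-limit set of `x` under `f`. -/
def sigmaLim {X : Type*} [TopologicalSpace X] (f : X → X) (x : X) : Set X :=
  {z | ∀ U : Set X, IsOpen U → z ∈ U →
    0 < Filter.limsup (fun n => birkhoffAvg f U n x) Filter.atTop}

/-- `k n = 2 ^ (2 ^ n)`. -/
def kseq (n : ℕ) : ℕ := 2 ^ 2 ^ n

/-- Length of the `n`-th binary word `w_n` in the length-then-value enumeration of all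
finite nonempty binary words (`w_0 = 0`, `w_1 = 1`, `w_2 = 00`, ...): the `n`-th word
consists of the binary digits of `n + 2` with the leading `1` removed. -/
def wordLen (n : ℕ) : ℕ := Nat.log 2 (n + 2)

/-- The `p`-th letter (counted from the left, `0 ≤ p < wordLen n`) of the word `w_n`. -/
def wordBit (n p : ℕ) : Bool := (n + 2).testBit (wordLen n - 1 - p)

/-- Whether `w_n` is a prefix of `c`. -/
def isPref (c : Sig) (n : ℕ) : Bool := decide (∀ p < wordLen n, c p = wordBit n p)

/-- Starting position of the `n`-th segment `A_n B_n^c w_n` in `x_c`;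
`|A_n| = kseq (2n)` and `|B_n^c w_n| = kseq (2n+1)`. -/
def segStart : ℕ → ℕ
  | 0 => 0
  | n + 1 => segStart n + kseq (2 * n) + kseq (2 * n + 1)

/-- Index of the segment containing position `j`. -/
def segIdx (j : ℕ) : ℕ := Nat.findGreatest (fun m => segStart m ≤ j) j

/-- The point `x_c = A_0 B_0^c w_0 A_1 B_1^c w_1 A_2 B_2^c w_2 ⋯`, where
`A_n = 0^{kseq (2n)}`, and `B_n^c` consists of `kseq (2n+1) - |w_n|` ones if `w_n` is a
prefix of `c` and of that many zeros otherwise. -/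
def xc (c : Sig) : Sig := fun j =>
  let n := segIdx j
  let r := j - segStart n
  if r < kseq (2 * n) then false
  else if r - kseq (2 * n) < kseq (2 * n + 1) - wordLen n then isPref c n
  else wordBit n (r - kseq (2 * n) - (kseq (2 * n + 1) - wordLen n))

theorem iterate_shiftMap (x : Sig) (k i : ℕ) : (shiftMap^[k] x) i = x (i + k) := by
  induction k generalizing x with
  | zero => rfl
  | succ k ih =>
    rw [Function.iterate_succ_apply, ih]
    rfl

theorem kseq_two_le (n : ℕ) : 2 ≤ kseq n := by
  have h : 2 ^ 1 ≤ 2 ^ 2 ^ n := Nat.pow_le_pow_right (by norm_num) Nat.one_le_two_pow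
  simpa [kseq] using h

theorem kseq_succ (n : ℕ) : kseq (n + 1) = kseq n * kseq n := by
  simp only [kseq, pow_succ, pow_mul, ← pow_two]

theorem lt_kseq (n : ℕ) : n < kseq n :=
  Nat.lt_two_pow_self.trans Nat.lt_two_pow_self

theorem segStart_le_kseq (n : ℕ) : segStart n ≤ kseq (2 * n) := by
  induction n with
  | zero => simp [segStart]
  | succ n ih =>
    have h := kseq_two_le (2 * n)
    rw [segStart, show 2 * (n + 1) = 2 * n + 1 + 1 by ring, kseq_succ (2 * n + 1),
      kseq_succ (2 * n)]
    generalize kseq (2 * n) = K at *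
    have h1 : 2 * K ≤ K * K := by gcongr
    have h2 : 2 * (K * K) ≤ (K * K) * (K * K) := by
      gcongr
      nlinarith
    omega

theorem segStart_strictMono : StrictMono segStart := by
  refine strictMono_nat_of_lt_succ fun n => ?_
  have := kseq_two_le (2 * n)
  rw [segStart]
  omega

theorem segIdx_eq {n j : ℕ} (h₁ : segStart n ≤ j) (h₂ : j < segStart (n + 1)) :
    segIdx j = n := by
  refine Nat.findGreatest_eq_iff.2 ⟨(segStart_strictMono.id_le n).trans h₁, fun _ => h₁, ?_⟩
  intro m hm _ h
  have := segStart_strictMono.monotone (Nat.succ_le_of_lt hm)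
  simp only [Nat.succ_eq_add_one] at this
  omega

theorem segStart_segIdx_le (j : ℕ) : segStart (segIdx j) ≤ j :=
  Nat.findGreatest_spec (P := fun m => segStart m ≤ j) (Nat.zero_le j) (Nat.zero_le j)

theorem lt_segStart_segIdx_succ (j : ℕ) : j < segStart (segIdx j + 1) := by
  by_contra! h
  exact Nat.findGreatest_is_greatest (P := fun m => segStart m ≤ j) (Nat.lt_succ_self _)
    ((segStart_strictMono.id_le _).trans h) h

theorem wordLen_le (n : ℕ) : wordLen n ≤ n + 1 := by
  have h : n + 2 < 2 ^ (n + 2) := Nat.lt_two_pow_self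
  have := Nat.log_lt_of_lt_pow (by omega) h
  rw [wordLen]
  omega

theorem xc_zeroBlock (c : Sig) {n r : ℕ} (hr : r < kseq (2 * n)) :
    xc c (segStart n + r) = false := by
  have h : segIdx (segStart n + r) = n := segIdx_eq (by omega) (by rw [segStart]; omega)
  simp [xc, h, hr]

theorem xc_prefBlock (c : Sig) {n r : ℕ} (hr : r < kseq (2 * n + 1) - wordLen n) :
    xc c (segStart n + kseq (2 * n) + r) = isPref c n := by
  have h : segIdx (segStart n + kseq (2 * n) + r) = n :=
    segIdx_eq (by omega) (by rw [segStart]; omega)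
  have h2 : segStart n + kseq (2 * n) + r - segStart n = kseq (2 * n) + r := by omega
  simp [xc, h, h2, hr]

/-- The positions in the `n`-th segment where two consecutive letters may differ. -/
def changePos (n : ℕ) : Finset ℕ :=
  insert (segStart n + kseq (2 * n) - 1)
    (Finset.Ico (segStart (n + 1) - wordLen n - 1) (segStart (n + 1)))

theorem card_changePos_le (n : ℕ) : (changePos n).card ≤ n + 3 := by
  refine (Finset.card_insert_le _ _).trans ?_
  have := wordLen_le n
  rw [Nat.card_Ico]
  omega

theorem mem_changePos (c : Sig) {j : ℕ} (h : xc c j ≠ xc c (j + 1)) :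
    j ∈ changePos (segIdx j) := by
  have h1 := segStart_segIdx_le j
  have h2 := lt_segStart_segIdx_succ j
  generalize segIdx j = n at *
  obtain ⟨r, rfl⟩ := Nat.exists_eq_add_of_le h1
  have h3 := kseq_two_le (2 * n)
  have h4 : segStart (n + 1) = segStart n + kseq (2 * n) + kseq (2 * n + 1) := rfl
  simp only [changePos, Finset.mem_insert, Finset.mem_Ico]
  by_contra! hc
  obtain ⟨hc1, hc2⟩ := hc
  have hr : segStart n + r < segStart (n + 1) - wordLen n - 1 := by
    by_contra! h'
    have := hc2 h'
    omega
  apply h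
  rcases lt_or_ge r (kseq (2 * n)) with hlt | hge
  · rw [xc_zeroBlock c hlt, add_assoc, xc_zeroBlock c (by omega)]
  · obtain ⟨s, rfl⟩ := Nat.exists_eq_add_of_le hge
    rw [← add_assoc, xc_prefBlock c (by omega), add_assoc _ s 1, xc_prefBlock c (by omega)]

theorem card_filter_change_le (c : Sig) (M : ℕ) :
    ((Finset.range M).filter fun j => xc c j ≠ xc c (j + 1)).card ≤
      (segIdx M + 1) * (segIdx M + 3) := by
  calc _ ≤ ((Finset.range (segIdx M + 1)).biUnion changePos).card := by
        refine Finset.card_le_card fun j hj => ?_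
        simp only [Finset.mem_filter, Finset.mem_range] at hj
        refine Finset.mem_biUnion.2 ⟨segIdx j, ?_, mem_changePos c hj.2⟩
        rw [Finset.mem_range]
        refine segStart_strictMono.lt_iff_lt.1 ?_
        exact (segStart_segIdx_le j).trans_lt (hj.1.trans (lt_segStart_segIdx_succ M))
    _ ≤ (Finset.range (segIdx M + 1)).card * (segIdx M + 3) := by
        refine Finset.card_biUnion_le_card_mul _ _ _ fun n hn => ?_
        have := Finset.mem_range.1 hn
        exact (card_changePos_le n).trans (by omega)
    _ = _ := by rw [Finset.card_range]

theorem two_pow_le_segStart (n : ℕ) : 2 ^ n ≤ segStart n + 1 := by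
  induction n with
  | zero => simp [segStart]
  | succ n ih =>
    have h : 2 ^ n ≤ kseq (2 * n) := by
      refine Nat.pow_le_pow_right (by norm_num) ?_
      have : 2 * n < 2 ^ (2 * n) := Nat.lt_two_pow_self
      omega
    rw [segStart, pow_succ]
    omega

theorem tendsto_segIdx : Tendsto segIdx atTop atTop := by
  refine tendsto_atTop.2 fun b => ?_
  filter_upwards [eventually_ge_atTop (segStart b)] with j hj
  exact Nat.lt_succ_iff.1 (segStart_strictMono.lt_iff_lt.1
    (hj.trans_lt (lt_segStart_segIdx_succ j)))

theorem tendsto_mul_div_two_pow :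
    Tendsto (fun n : ℕ => ((n + 1 : ℝ) * (n + 3)) / 2 ^ n) atTop (𝓝 0) := by
  have h (k : ℕ) := tendsto_pow_const_div_const_pow_of_one_lt k (r := (2 : ℝ)) (by norm_num)
  have := ((h 2).add ((h 1).const_mul 4)).add ((h 0).const_mul 3)
  simp only [mul_zero, add_zero] at this
  refine this.congr fun n => ?_
  ring

theorem birkhoffAvg_nonneg {X : Type*} (f : X → X) (U : Set X) (n : ℕ) (x : X) :
    0 ≤ birkhoffAvg f U n x :=
  div_nonneg (Finset.sum_nonneg fun _ _ => indicator_nonneg (fun _ _ => zero_le_one) _)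
    (Nat.cast_nonneg n)

theorem birkhoffAvg_eq_card {X : Type*} (f : X → X) (U : Set X) (n : ℕ) (x : X)
    [DecidablePred fun k => f^[k] x ∈ U] :
    birkhoffAvg f U n x = ((Finset.range n).filter fun k => f^[k] x ∈ U).card / n := by
  classical
  simp [birkhoffAvg, indicator_apply]

theorem birkhoffAvg_le_one {X : Type*} (f : X → X) (U : Set X) (n : ℕ) (x : X) :
    birkhoffAvg f U n x ≤ 1 := by
  classical
  rw [birkhoffAvg_eq_card]
  refine div_le_one_of_le₀ ?_ (Nat.cast_nonneg n)
  exact_mod_cast (Finset.card_filter_le _ _).trans_eq (Finset.card_range n)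

theorem tendsto_birkhoffAvg_change (c : Sig) (p : ℕ) :
    Tendsto (fun n => birkhoffAvg shiftMap {y : Sig | y p ≠ y (p + 1)} n (xc c)) atTop
      (𝓝 0) := by
  have hlim := (tendsto_mul_div_two_pow.comp
    (tendsto_segIdx.comp (tendsto_add_atTop_nat p))).mul_const (p + 2 : ℝ)
  rw [zero_mul] at hlim
  refine tendsto_of_tendsto_of_tendsto_of_le_of_le' tendsto_const_nhds hlim
    (Eventually.of_forall fun n => birkhoffAvg_nonneg _ _ _ _) ?_
  filter_upwards [eventually_ge_atTop 1] with n hn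
  have hcard : ((Finset.range n).filter fun k =>
      shiftMap^[k] (xc c) ∈ {y : Sig | y p ≠ y (p + 1)}).card ≤
      (segIdx (n + p) + 1) * (segIdx (n + p) + 3) := by
    refine le_trans ?_ (card_filter_change_le c (n + p))
    refine Finset.card_le_card_of_injOn (· + p) (fun k hk => ?_) (add_left_injective p).injOn
    simp only [Finset.coe_filter, Finset.mem_range, mem_ofPred_eq, iterate_shiftMap] at hk ⊢
    rw [add_comm p k, show p + 1 + k = k + p + 1 by omega] at hk
    exact ⟨by omega, hk.2⟩
  have hpow : 2 ^ segIdx (n + p) ≤ n * (p + 2) := by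
    have h1 := two_pow_le_segStart (segIdx (n + p))
    have h2 := segStart_segIdx_le (n + p)
    nlinarith
  rw [birkhoffAvg_eq_card]
  simp only [Function.comp_apply]
  have hpos : (0 : ℝ) < n := by exact_mod_cast hn
  rw [div_mul_eq_mul_div, div_le_div_iff₀ hpos (by positivity)]
  have hcard' : (((Finset.range n).filter fun k =>
      shiftMap^[k] (xc c) ∈ {y : Sig | y p ≠ y (p + 1)}).card : ℝ) ≤
      (segIdx (n + p) + 1) * (segIdx (n + p) + 3) := by exact_mod_cast hcard
  have hpow' : (2 : ℝ) ^ segIdx (n + p) ≤ n * (p + 2) := by exact_mod_cast hpow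
  calc _ ≤ ((segIdx (n + p) + 1) * (segIdx (n + p) + 3) : ℝ) * (n * (p + 2)) := by gcongr
    _ = _ := by ring

theorem exists_cylinder_subset {U : Set Sig} (hU : IsOpen U) {z : Sig} (hz : z ∈ U) :
    ∃ m, ∀ y : Sig, (∀ i < m, y i = z i) → y ∈ U := by
  obtain ⟨I, u, hu, hsub⟩ := isOpen_pi_iff.1 hU z hz
  refine ⟨I.sup id + 1, fun y hy => hsub fun i hi => ?_⟩
  rw [hy i (Nat.lt_succ_of_le (Finset.le_sup (f := id) hi))]
  exact (hu i hi).2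

theorem const_mem_sigmaLim {x : Sig} {b : Bool}
    (h : ∀ n₀, ∃ a L, n₀ ≤ L ∧ a ≤ 2 * L ∧ ∀ r < L, x (a + r) = b) :
    (fun _ => b) ∈ sigmaLim shiftMap x := by
  classical
  intro U hU hz
  obtain ⟨m, hm⟩ := exists_cylinder_subset hU hz
  refine lt_of_lt_of_le (by norm_num : (0 : ℝ) < 1 / 6) (le_limsup_of_frequently_le ?_ ?_)
  · refine frequently_atTop.2 fun n₀ => ?_
    obtain ⟨a, L, hL, ha, hx⟩ := h (n₀ + 2 * m + 1)
    refine ⟨a + L, by omega, ?_⟩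
    have hcard : L - m ≤ ((Finset.range (a + L)).filter fun k => shiftMap^[k] x ∈ U).card := by
      calc L - m = (Finset.Ico a (a + (L - m))).card := by simp
        _ ≤ _ := by
          refine Finset.card_le_card fun k hk => ?_
          rw [Finset.mem_Ico] at hk
          rw [Finset.mem_filter, Finset.mem_range]
          refine ⟨by omega, hm _ fun i hi => ?_⟩
          rw [iterate_shiftMap, show i + k = a + (i + k - a) by omega]
          exact hx _ (by omega)
    have hle : a + L ≤
        6 * ((Finset.range (a + L)).filter fun k => shiftMap^[k] x ∈ U).card := by omega
    have hle' : ((a + L : ℕ) : ℝ) ≤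
        6 * ((Finset.range (a + L)).filter fun k => shiftMap^[k] x ∈ U).card := by
      exact_mod_cast hle
    have hpos : (0 : ℝ) < (a + L : ℕ) := by
      exact_mod_cast (by omega : 0 < a + L)
    rw [birkhoffAvg_eq_card, div_le_div_iff₀ (by norm_num) hpos]
    linarith
  · exact isBoundedUnder_of ⟨1, fun n => birkhoffAvg_le_one _ _ _ _⟩

/-- The number with binary digits `1 c₀ c₁ ⋯ c_{l-1}`. -/
def leadOneCode (c : Sig) : ℕ → ℕ
  | 0 => 1
  | l + 1 => Nat.bit (c l) (leadOneCode c l)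

theorem leadOneCode_bounds (c : Sig) (l : ℕ) :
    2 ^ l ≤ leadOneCode c l ∧ leadOneCode c l < 2 ^ (l + 1) := by
  induction l with
  | zero => simp [leadOneCode]
  | succ l ih =>
    rw [leadOneCode, Nat.bit_val, pow_succ, pow_succ _ (l + 1)]
    have := Bool.toNat_le (c l)
    omega

theorem testBit_leadOneCode (c : Sig) {l p : ℕ} (hp : p < l) :
    (leadOneCode c l).testBit (l - 1 - p) = c p := by
  induction l with
  | zero => omega
  | succ l ih =>
    rw [leadOneCode]
    rcases Nat.lt_succ_iff_lt_or_eq.1 hp with h | rfl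
    · rw [show l + 1 - 1 - p = l - 1 - p + 1 by omega, Nat.testBit_bit_succ, ih h]
    · simp

theorem exists_isPref (c : Sig) (n₀ : ℕ) : ∃ n ≥ n₀, isPref c n = true := by
  obtain ⟨h1, h2⟩ := leadOneCode_bounds c (n₀ + 1)
  have h3 : n₀ + 1 < 2 ^ (n₀ + 1) := Nat.lt_two_pow_self
  have h4 : leadOneCode c (n₀ + 1) - 2 + 2 = leadOneCode c (n₀ + 1) := by omega
  have hlen : wordLen (leadOneCode c (n₀ + 1) - 2) = n₀ + 1 := by
    rw [wordLen, h4]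
    exact Nat.log_eq_of_pow_le_of_lt_pow h1 h2
  refine ⟨leadOneCode c (n₀ + 1) - 2, by omega, decide_eq_true fun p hp => ?_⟩
  rw [hlen] at hp
  rw [wordBit, hlen, h4, testBit_leadOneCode c hp]

theorem false_mem_sigmaLim (c : Sig) : (fun _ => false) ∈ sigmaLim shiftMap (xc c) := by
  refine const_mem_sigmaLim fun n => ⟨segStart n, kseq (2 * n), ?_, ?_, ?_⟩
  · have := lt_kseq (2 * n)
    omega
  · have := segStart_le_kseq n
    omega
  · exact fun r hr => xc_zeroBlock c hr

theorem true_mem_sigmaLim (c : Sig) : (fun _ => true) ∈ sigmaLim shiftMap (xc c) := by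
  refine const_mem_sigmaLim fun n₀ => ?_
  obtain ⟨n, hn, hpref⟩ := exists_isPref c n₀
  have h1 := segStart_le_kseq n
  have h2 := lt_kseq (2 * n)
  have h3 : wordLen n + kseq (2 * n) ≤ kseq (2 * n + 1) := by
    have := wordLen_le n
    have := kseq_two_le (2 * n)
    rw [kseq_succ]
    nlinarith
  refine ⟨segStart n + kseq (2 * n), kseq (2 * n + 1) - wordLen n, ?_, ?_, ?_⟩
  · omega
  · omega
  · exact fun r hr => (xc_prefBlock c hr).trans hpref

/-- for every `c ∈ Σ`, the σ-limit set of `x_c` under the shift consists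
exactly of the two constant sequences `0^∞` and `1^∞`. -/
theorem stmt13 (c : Sig) :
    sigmaLim shiftMap (xc c) =
      ({fun _ => false, fun _ => true} : Set Sig) := by
  refine Subset.antisymm (fun z hz => ?_) ?_
  · by_cases hconst : ∀ p, z p = z (p + 1)
    · have hz0 : z = fun _ => z 0 := by
        funext p
        induction p with
        | zero => rfl
        | succ p ih => rw [← hconst p, ih]
      rw [hz0]
      cases z 0 <;> simp
    · push Not at hconst
      obtain ⟨p, hp⟩ := hconst
      have hopen : IsOpen {y : Sig | y p ≠ y (p + 1)} :=
        isOpen_ne_fun (continuous_apply p) (continuous_apply (p + 1))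
      have hlim := hz _ hopen hp
      rw [(tendsto_birkhoffAvg_change c p).limsup_eq] at hlim
      exact absurd hlim (lt_irrefl 0)
  · rintro _ (rfl | rfl)
    · exact false_mem_sigmaLim c
    · exact true_mem_sigmaLim c
end

section
/- For every c ∈ Σ = {0,1}^ℕ, the forward orbit {T^n(x_c) : n ≥ 0} of the point x_c under the shift map T is dense in Σ; equivalently, every finite binary word occurs as a subword of x_c. -/
open MeasureTheory Set Filter Topology

theorem iterate_shiftMap_apply (x : Sig) (n i : ℕ) : shiftMap^[n] x i = x (n + i) := by
  induction n generalizing x with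
  | zero => simp
  | succ n ih =>
    rw [Function.iterate_succ_apply, ih, shiftMap]
    congr 1
    omega

theorem kseq_pos (n : ℕ) : 0 < kseq n := by
  unfold kseq
  positivity

theorem wordLen_le_kseq (n : ℕ) : wordLen n ≤ kseq (2 * n + 1) := by
  have h₁ : wordLen n < n + 2 := Nat.log_lt_self 2 (by omega)
  have h₂ : 2 * n + 1 < 2 ^ (2 * n + 1) := Nat.lt_two_pow_self
  have h₃ : 2 ^ (2 * n + 1) < kseq (2 * n + 1) := Nat.lt_two_pow_self
  omega

/-- The word `w_n` occupies the last `wordLen n` positions of the `n`-th segment of `x_c`. -/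
theorem xc_word (c : Sig) {n p : ℕ} (hp : p < wordLen n) :
    xc c (segStart n + kseq (2 * n) + (kseq (2 * n + 1) - wordLen n) + p) = wordBit n p := by
  have hk := wordLen_le_kseq n
  have hidx : segIdx (segStart n + kseq (2 * n) + (kseq (2 * n + 1) - wordLen n) + p) = n := by
    apply segIdx_eq
    · omega
    · simp only [segStart]
      omega
  simp only [xc, hidx]
  rw [if_neg (by omega), if_neg (by omega)]
  congr 1
  omega

theorem exists_testBit_eq (z : Sig) (L : ℕ) :
    ∃ N, 2 ^ L ≤ N ∧ N < 2 ^ (L + 1) ∧ ∀ p < L, N.testBit (L - 1 - p) = z p := by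
  induction L with
  | zero => exact ⟨1, by simp⟩
  | succ L ih =>
    obtain ⟨N, h₁, h₂, h₃⟩ := ih
    refine ⟨Nat.bit (z L) N, ?_, ?_, fun p hp => ?_⟩
    · rw [Nat.bit_val, pow_succ]
      omega
    · have := Bool.toNat_le (z L)
      rw [Nat.bit_val, pow_succ]
      omega
    · rcases Nat.lt_succ_iff_lt_or_eq.1 hp with h | rfl
      · rw [show L + 1 - 1 - p = L - 1 - p + 1 by omega, Nat.testBit_bit_succ, h₃ p h]
      · simp

theorem exists_word (z : Sig) {L : ℕ} (hL : L ≠ 0) :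
    ∃ n, wordLen n = L ∧ ∀ p < L, wordBit n p = z p := by
  obtain ⟨N, h₁, h₂, h₃⟩ := exists_testBit_eq z L
  have h : 2 ≤ N := (Nat.le_self_pow hL 2).trans h₁
  have hlen : wordLen (N - 2) = L := by
    rw [wordLen, Nat.sub_add_cancel h]
    exact Nat.log_eq_of_pow_le_of_lt_pow h₁ h₂
  refine ⟨N - 2, hlen, fun p hp => ?_⟩
  rw [wordBit, hlen, Nat.sub_add_cancel h, h₃ p hp]

theorem exists_xc_eq (c z : Sig) (L : ℕ) : ∃ m, ∀ p < L, xc c (m + p) = z p := by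
  rcases eq_or_ne L 0 with rfl | hL
  · exact ⟨0, by simp⟩
  · obtain ⟨n, rfl, hn⟩ := exists_word z hL
    exact ⟨_, fun p hp => (xc_word c hp).trans (hn p hp)⟩

/-- for every `c ∈ Σ`, the forward orbit of `x_c` under the shift is dense
in `Σ`; equivalently, every finite binary word occurs as a subword of `x_c`. -/
theorem stmt15 (c : Sig) :
    Dense (Set.range fun n => shiftMap^[n] (xc c)) ∧
    ∀ w : List Bool, ∃ m : ℕ, ∀ p < w.length, xc c (m + p) = w.getD p false := by
  refine ⟨?_, fun w => exists_xc_eq c (fun p => w.getD p false) w.length⟩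
  refine (PiNat.isTopologicalBasis_cylinders fun _ : ℕ => Bool).dense_iff.2 ?_
  rintro _ ⟨z, L, rfl⟩ -
  obtain ⟨m, hm⟩ := exists_xc_eq c z L
  refine ⟨shiftMap^[m] (xc c), fun p hp => ?_, m, rfl⟩
  rw [iterate_shiftMap_apply, hm p hp]
end
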